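/- Let F be a skew product such that ℙ×Leb is ergodic with respect to F and F satisfies the skew-product fluctuation law with constants γ₀ < γ₁ in (0,1): for i = 0,1 and every α ∈ (0,1), liminf_{n→∞} (ℙ×Leb)( { (ω,x) : (1/n)∑_{j=0}^{n-1} 1_{I_i(γ_i)}(f_ω^j(x)) ≤ α } ) < 1. Then for (ℙ×Leb)-almost every (ω,x) ∈ Ω×[0,1]: liminf_{n→∞} (1/n)∑_{j=0}^{n-1} f_ω^j(x) ≤ γ₀ and limsup_{n→∞} (1/n)∑_{j=0}^{n-1} f_ω^j(x) ≥ γ₁; in particular the Birkhoff averages (1/n)∑_{j=0}^{n-1} f_ω^j(x) fail to converge for (ℙ×Leb)-almost every point. -/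

import Mathlib

open MeasureTheory Filter Set

noncomputable section

/-- Fiber compositions of a skew product over the base map `σ`:
`fib σ f ω n = f_{σ^{n-1} ω} ∘ ⋯ ∘ f_ω`. -/
def fib {Ω : Type*} (σ : Ω → Ω) (f : Ω → ℝ → ℝ) (ω : Ω) : ℕ → ℝ → ℝ
  | 0 => id
  | n + 1 => f (σ^[n] ω) ∘ fib σ f ω n

/-- The reference measure `ℙ × Leb` on `Ω × [0,1]`. -/
def refMeasure {Ω : Type*} [MeasurableSpace Ω] (ℙ : Measure Ω) : Measure (Ω × ℝ) :=
  ℙ.prod (volume.restrict (Set.Icc (0:ℝ) 1))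

/-- `ℙ × Leb` is ergodic with respect to the skew product `F(ω,x) = (σ ω, f ω x)`:
every measurable subset `A` of `Ω × [0,1]` with `F(A) ⊆ A` has measure `0` or `1`. -/
def ErgodicRef {Ω : Type*} [MeasurableSpace Ω] (ℙ : Measure Ω) (σ : Ω → Ω)
    (f : Ω → ℝ → ℝ) : Prop :=
  ∀ A : Set (Ω × ℝ), MeasurableSet A → A ⊆ Set.univ ×ˢ Set.Icc (0:ℝ) 1 →
    (fun q : Ω × ℝ => (σ q.1, f q.1 q.2)) '' A ⊆ A →
    refMeasure ℙ A = 0 ∨ refMeasure ℙ A = 1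

theorem fib_shift {Ω : Type*} (σ : Ω → Ω) (f : Ω → ℝ → ℝ) (ω : Ω) (x : ℝ) (n : ℕ) :
    fib σ f ω (n + 1) x = fib σ f (σ ω) n (f ω x) := by
  induction n with
  | zero => simp [fib]
  | succ n ih =>
    rw [fib, Function.comp_apply, ih, fib, Function.comp_apply, Function.iterate_succ_apply]

theorem fib_measurable {Ω : Type*} [MeasurableSpace Ω] (σ : Ω → Ω) (hσ : Measurable σ)
    (f : Ω → ℝ → ℝ) (hfm : Measurable (Function.uncurry f)) (n : ℕ) :
    Measurable (fun q : Ω × ℝ => fib σ f q.1 n q.2) := by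
  induction n with
  | zero => simpa [fib] using measurable_snd
  | succ n ih =>
    exact hfm.comp (((hσ.iterate n).comp measurable_fst).prodMk ih)

theorem fib_mem {Ω : Type*} (σ : Ω → Ω) (f : Ω → ℝ → ℝ)
    (hfI : ∀ ω, MapsTo (f ω) (Icc (0:ℝ) 1) (Icc (0:ℝ) 1)) (ω : Ω) (x : ℝ)
    (hx : x ∈ Icc (0:ℝ) 1) (n : ℕ) : fib σ f ω n x ∈ Icc (0:ℝ) 1 := by
  induction n with
  | zero => simpa [fib] using hx
  | succ n ih => exact hfI _ ih

theorem key_freq {Ω : Type*} [MeasurableSpace Ω]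
    (ℙ : Measure Ω) [IsProbabilityMeasure ℙ] (σ : Ω → Ω) (hσ : Measurable σ)
    (f : Ω → ℝ → ℝ) (hfm : Measurable (Function.uncurry f))
    (hfI : ∀ ω, MapsTo (f ω) (Icc (0:ℝ) 1) (Icc (0:ℝ) 1))
    (herg : ErgodicRef ℙ σ f) (g : ℝ → ℝ) (hg : Measurable g) (hg0 : ∀ x, 0 ≤ g x)
    (hg1 : ∀ x, g x ≤ 1) (α : ℝ)
    (hFL : Filter.liminf (fun n : ℕ => refMeasure ℙ {q : Ω × ℝ | (n:ℝ)⁻¹ *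
        ∑ j ∈ Finset.range n, g (fib σ f q.1 j q.2) ≤ α}) atTop < 1) :
    ∀ᵐ q ∂(refMeasure ℙ), ∀ k : ℕ, ∃ᶠ n : ℕ in atTop, α - 1 / ((k:ℝ) + 1) < (n:ℝ)⁻¹ *
        ∑ j ∈ Finset.range n, g (fib σ f q.1 j q.2) := by
  have hprob : IsProbabilityMeasure (volume.restrict (Set.Icc (0:ℝ) 1)) :=
    ⟨by simp⟩
  have hprob' : IsProbabilityMeasure (refMeasure ℙ) := by
    unfold refMeasure; infer_instance
  set S : ℕ → Ω × ℝ → ℝ := fun n q => (n:ℝ)⁻¹ *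
        ∑ j ∈ Finset.range n, g (fib σ f q.1 j q.2) with hS
  have hSm : ∀ n, Measurable (S n) := fun n =>
    (Finset.measurable_sum _ fun j _ => hg.comp (fib_measurable σ hσ f hfm j)).const_mul _
  have hfreq : ∀ β : ℝ, MeasurableSet {q | ∃ᶠ n in atTop, β < S n q} := by
    intro β
    simp only [Filter.frequently_atTop, ofPred_forall, ofPred_exists, ofPred_and]
    refine MeasurableSet.iInter fun a => MeasurableSet.iUnion fun b => ?_
    exact (MeasurableSet.const _).inter (measurableSet_lt measurable_const (hSm b))
  set E : Set (Ω × ℝ) := (Set.univ ×ˢ Set.Icc (0:ℝ) 1) ∩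
    {q | ∀ k : ℕ, ∃ᶠ n in atTop, α - 1 / ((k:ℝ) + 1) < S n q} with hE
  have hEm : MeasurableSet E := by
    refine (MeasurableSet.univ.prod measurableSet_Icc).inter ?_
    rw [ofPred_forall]
    exact MeasurableSet.iInter fun k => hfreq _
  have hinv : (fun q : Ω × ℝ => (σ q.1, f q.1 q.2)) '' E ⊆ E := by
    rintro _ ⟨q, ⟨hq1, hq2⟩, rfl⟩
    refine ⟨⟨trivial, hfI _ hq1.2⟩, fun k => ?_⟩
    have h1 := hq2 (2 * k + 1)
    have hev : ∀ᶠ n : ℕ in atTop, 2 * k + 2 ≤ n := eventually_ge_atTop _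
    have h2 := h1.and_eventually hev
    rw [Filter.frequently_atTop] at h2 ⊢
    intro N
    obtain ⟨m, hm, hlt, hmk⟩ := h2 (N + 1)
    obtain ⟨n, rfl⟩ : ∃ n, m = n + 1 := ⟨m - 1, by omega⟩
    refine ⟨n, by omega, ?_⟩
    have hn : (0:ℝ) < n := by
      have : 0 < n := by omega
      exact_mod_cast this
    simp only [hS] at hlt ⊢
    rw [Finset.sum_range_succ'] at hlt
    simp only [fib_shift] at hlt
    set T := ∑ j ∈ Finset.range n, g (fib σ f (σ q.1) j (f q.1 q.2)) with hT
    have hT0 : 0 ≤ T := Finset.sum_nonneg fun j _ => hg0 _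
    have hgq := hg1 (fib σ f q.1 0 q.2)
    have hmk' : (2 * k + 2 : ℝ) ≤ n + 1 := by exact_mod_cast hmk
    have e1 : ((n:ℝ) + 1)⁻¹ * T ≤ (n:ℝ)⁻¹ * T := by gcongr; linarith
    have e2 : ((n:ℝ) + 1)⁻¹ * g (fib σ f q.1 0 q.2) ≤ (2 * k + 2 : ℝ)⁻¹ := by
      calc _ ≤ ((n:ℝ) + 1)⁻¹ * 1 := by gcongr
        _ ≤ _ := by rw [mul_one]; gcongr
    have e3 : 1 / (((2 * k + 1 : ℕ) : ℝ) + 1) + (2 * k + 2 : ℝ)⁻¹ = 1 / ((k:ℝ) + 1) := by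
      push_cast; field_simp; ring
    push_cast at hlt e3
    rw [mul_add] at hlt
    linarith
  have hIcc : ∀ᵐ q ∂(refMeasure ℙ), q ∈ (Set.univ : Set Ω) ×ˢ Set.Icc (0:ℝ) 1 := by
    refine (mem_ae_iff_prob_eq_one₀
      (MeasurableSet.univ.prod measurableSet_Icc).nullMeasurableSet).2 ?_
    simp [refMeasure, Measure.prod_prod]
  rcases herg E hEm inter_subset_left hinv with h0 | h1
  · exfalso
    have hae : ∀ᵐ q ∂(refMeasure ℙ), ∀ᶠ n in atTop, S n q ≤ α := by
      filter_upwards [measure_eq_zero_iff_ae_notMem.1 h0, hIcc] with q hq hq'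
      by_contra hcon
      refine hq ⟨hq', fun k => ?_⟩
      rw [Filter.not_eventually] at hcon
      refine hcon.mono fun n hn => ?_
      have : 0 < 1 / ((k:ℝ) + 1) := by positivity
      push Not at hn
      linarith
    have hfat := lintegral_liminf_le (μ := refMeasure ℙ) (u := (atTop : Filter ℕ))
      (f := fun n => {q | S n q ≤ α}.indicator (1 : Ω × ℝ → ENNReal))
      (fun n => measurable_one.indicator (measurableSet_le (hSm n) measurable_const))
    have hc : ∫⁻ q, liminf (fun n => {q | S n q ≤ α}.indicator (1 : Ω × ℝ → ENNReal) q) atTop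
        ∂(refMeasure ℙ) = 1 := by
      have : ∀ᵐ q ∂(refMeasure ℙ),
          liminf (fun n => {q | S n q ≤ α}.indicator (1 : Ω × ℝ → ENNReal) q) atTop = 1 := by
        filter_upwards [hae] with q hq
        refine Tendsto.liminf_eq (tendsto_const_nhds.congr' ?_)
        filter_upwards [hq] with n hn
        simp [hn]
      rw [lintegral_congr_ae this]
      simp
    rw [hc] at hfat
    simp only [lintegral_indicator_one (measurableSet_le (hSm _) measurable_const)] at hfat
    exact absurd hFL (not_lt.2 hfat)
  · have := (mem_ae_iff_prob_eq_one₀ hEm.nullMeasurableSet).2 h1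
    filter_upwards [this] with q hq
    exact hq.2

theorem key_freq' {Ω : Type*} [MeasurableSpace Ω]
    (ℙ : Measure Ω) [IsProbabilityMeasure ℙ] (σ : Ω → Ω) (hσ : Measurable σ)
    (f : Ω → ℝ → ℝ) (hfm : Measurable (Function.uncurry f))
    (hfI : ∀ ω, MapsTo (f ω) (Icc (0:ℝ) 1) (Icc (0:ℝ) 1))
    (herg : ErgodicRef ℙ σ f) (g : ℝ → ℝ) (hg : Measurable g) (hg0 : ∀ x, 0 ≤ g x)
    (hg1 : ∀ x, g x ≤ 1)
    (hFL : ∀ α ∈ Ioo (0:ℝ) 1, Filter.liminf (fun n : ℕ => refMeasure ℙ {q : Ω × ℝ | (n:ℝ)⁻¹ *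
        ∑ j ∈ Finset.range n, g (fib σ f q.1 j q.2) ≤ α}) atTop < 1) :
    ∀ᵐ q ∂(refMeasure ℙ), ∀ ε > 0, ∃ᶠ n : ℕ in atTop, 1 - ε < (n:ℝ)⁻¹ *
        ∑ j ∈ Finset.range n, g (fib σ f q.1 j q.2) := by
  have h : ∀ m : ℕ, _ := fun m : ℕ => key_freq ℙ σ hσ f hfm hfI herg g hg hg0 hg1
    (1 - 1 / ((m:ℝ) + 2)) (hFL _ ⟨by
      have : 1 / ((m:ℝ) + 2) < 1 := by
        rw [div_lt_one (by positivity)]; linarith [(Nat.cast_nonneg m : (0:ℝ) ≤ m)]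
      linarith, by
      have : 0 < 1 / ((m:ℝ) + 2) := by positivity
      linarith⟩)
  filter_upwards [ae_all_iff.2 h] with q hq ε hε
  obtain ⟨m, hm⟩ := exists_nat_one_div_lt (half_pos hε)
  refine (hq m m).mono fun n hn => ?_
  have : 1 / ((m:ℝ) + 2) ≤ 1 / ((m:ℝ) + 1) := by gcongr; norm_num
  linarith

theorem statement1 {Ω : Type*} [MeasurableSpace Ω] [StandardBorelSpace Ω]
    (ℙ : Measure Ω) [IsProbabilityMeasure ℙ] (σ : Ω → Ω) (hσ : Ergodic σ ℙ)
    (f : Ω → ℝ → ℝ) (hfm : Measurable (Function.uncurry f))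
    (hfI : ∀ ω, MapsTo (f ω) (Icc (0:ℝ) 1) (Icc (0:ℝ) 1))
    (herg : ErgodicRef ℙ σ f)
    (γ₀ γ₁ : ℝ) (hγ₀ : γ₀ ∈ Ioo (0:ℝ) 1) (hγ₁ : γ₁ ∈ Ioo (0:ℝ) 1) (hγ : γ₀ < γ₁)
    (hFL0 : ∀ α ∈ Ioo (0:ℝ) 1,
      Filter.liminf (fun n : ℕ => refMeasure ℙ {q : Ω × ℝ | (n:ℝ)⁻¹ *
        ∑ j ∈ Finset.range n, (Icc (0:ℝ) γ₀).indicator 1 (fib σ f q.1 j q.2) ≤ α})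
        atTop < 1)
    (hFL1 : ∀ α ∈ Ioo (0:ℝ) 1,
      Filter.liminf (fun n : ℕ => refMeasure ℙ {q : Ω × ℝ | (n:ℝ)⁻¹ *
        ∑ j ∈ Finset.range n, (Icc γ₁ (1:ℝ)).indicator 1 (fib σ f q.1 j q.2) ≤ α})
        atTop < 1) :
    ∀ᵐ q ∂(refMeasure ℙ),
      Filter.liminf (fun n : ℕ => (n:ℝ)⁻¹ * ∑ j ∈ Finset.range n, fib σ f q.1 j q.2)
        atTop ≤ γ₀ ∧
      γ₁ ≤ Filter.limsup (fun n : ℕ => (n:ℝ)⁻¹ * ∑ j ∈ Finset.range n, fib σ f q.1 j q.2)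
        atTop ∧
      ¬ ∃ c : ℝ, Tendsto (fun n : ℕ => (n:ℝ)⁻¹ * ∑ j ∈ Finset.range n, fib σ f q.1 j q.2)
        atTop (nhds c) := by
  have hm := hσ.measurable
  have hind : ∀ s : Set ℝ, ∀ x, 0 ≤ s.indicator (1 : ℝ → ℝ) x ∧ s.indicator (1 : ℝ → ℝ) x ≤ 1 := by
    intro s x
    by_cases h : x ∈ s <;> simp [h]
  have h0 := key_freq' ℙ σ hm f hfm hfI herg ((Icc (0:ℝ) γ₀).indicator 1)
    (measurable_one.indicator measurableSet_Icc) (fun x => (hind _ x).1) (fun x => (hind _ x).2) hFL0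
  have h1 := key_freq' ℙ σ hm f hfm hfI herg ((Icc γ₁ (1:ℝ)).indicator 1)
    (measurable_one.indicator measurableSet_Icc) (fun x => (hind _ x).1) (fun x => (hind _ x).2) hFL1
  have hIcc : ∀ᵐ q ∂(refMeasure ℙ), q.2 ∈ Set.Icc (0:ℝ) 1 := by
    have : ∀ᵐ x ∂(volume.restrict (Set.Icc (0:ℝ) 1)), x ∈ Set.Icc (0:ℝ) 1 :=
      ae_restrict_mem measurableSet_Icc
    exact Measure.quasiMeasurePreserving_snd.ae this
  filter_upwards [h0, h1, hIcc] with q hq0 hq1 hq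
  have hmem := fib_mem σ f hfI q.1 q.2 hq
  set a : ℕ → ℝ := fun n => (n:ℝ)⁻¹ * ∑ j ∈ Finset.range n, fib σ f q.1 j q.2 with ha
  have ha0 : ∀ n, 0 ≤ a n := fun n =>
    mul_nonneg (by positivity) (Finset.sum_nonneg fun j _ => (hmem j).1)
  have ha1 : ∀ n, a n ≤ 1 := by
    intro n
    have : ∑ j ∈ Finset.range n, fib σ f q.1 j q.2 ≤ n := by
      calc _ ≤ ∑ j ∈ Finset.range n, (1:ℝ) := Finset.sum_le_sum fun j _ => (hmem j).2
        _ = n := by simp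
    calc a n ≤ (n:ℝ)⁻¹ * n := by simp only [ha]; gcongr
      _ ≤ 1 := inv_mul_le_one
  have hbb : IsBoundedUnder (· ≥ ·) atTop a := isBoundedUnder_of ⟨0, ha0⟩
  have hba : IsBoundedUnder (· ≤ ·) atTop a := isBoundedUnder_of ⟨1, ha1⟩
  have hlow : liminf a atTop ≤ γ₀ := by
    refine le_of_forall_pos_le_add fun ε hε => ?_
    refine liminf_le_of_frequently_le ?_ hbb
    refine ((hq0 ε hε).and_eventually (eventually_gt_atTop 0)).mono ?_
    rintro n ⟨hn, hn0⟩
    have hn0' : (0:ℝ) < n := by exact_mod_cast hn0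
    set s := ∑ j ∈ Finset.range n, (Icc (0:ℝ) γ₀).indicator (1 : ℝ → ℝ) (fib σ f q.1 j q.2)
    have hle : ∑ j ∈ Finset.range n, fib σ f q.1 j q.2 ≤ n - (1 - γ₀) * s := by
      calc _ ≤ ∑ j ∈ Finset.range n, (1 - (1 - γ₀) *
              (Icc (0:ℝ) γ₀).indicator (1 : ℝ → ℝ) (fib σ f q.1 j q.2)) := by
            refine Finset.sum_le_sum fun j _ => ?_
            by_cases h : fib σ f q.1 j q.2 ∈ Icc (0:ℝ) γ₀
            · simp only [indicator_of_mem h, Pi.one_apply]; linarith [h.2]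
            · simp only [indicator_of_notMem h]; linarith [(hmem j).2]
        _ = _ := by rw [Finset.sum_sub_distrib, ← Finset.mul_sum]; simp [s]
    have h3 : a n ≤ 1 - (1 - γ₀) * ((n:ℝ)⁻¹ * s) := by
      calc a n ≤ (n:ℝ)⁻¹ * (n - (1 - γ₀) * s) := by simp only [ha]; gcongr
        _ = _ := by field_simp
    have := hγ₀.1
    have := hγ₀.2
    nlinarith
  have hhigh : γ₁ ≤ limsup a atTop := by
    refine le_of_forall_pos_le_add fun ε hε => ?_
    rw [← sub_le_iff_le_add]
    refine le_limsup_of_frequently_le ?_ hba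
    refine (hq1 ε hε).mono fun n hn => ?_
    set s := ∑ j ∈ Finset.range n, (Icc γ₁ (1:ℝ)).indicator (1 : ℝ → ℝ) (fib σ f q.1 j q.2)
    have hle : γ₁ * s ≤ ∑ j ∈ Finset.range n, fib σ f q.1 j q.2 := by
      simp only [s]
      rw [Finset.mul_sum]
      refine Finset.sum_le_sum fun j _ => ?_
      by_cases h : fib σ f q.1 j q.2 ∈ Icc γ₁ (1:ℝ)
      · simp only [indicator_of_mem h, Pi.one_apply]; linarith [h.1]
      · simp only [indicator_of_notMem h]; linarith [(hmem j).1]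
    have h3 : γ₁ * ((n:ℝ)⁻¹ * s) ≤ a n := by
      calc γ₁ * ((n:ℝ)⁻¹ * s) = (n:ℝ)⁻¹ * (γ₁ * s) := by ring
        _ ≤ a n := by simp only [ha]; gcongr
    have := hγ₁.1
    have := hγ₁.2
    nlinarith
  refine ⟨hlow, hhigh, ?_⟩
  rintro ⟨c, hc⟩
  have e1 := hc.liminf_eq
  have e2 := hc.limsup_eq
  linarith
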